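/- For every real s > 0, 2·∫_0^∞ cos(sx) · x / ((1 + x²)·(e^{πx} - 1)) dx = -1 + cosh(s)·( log(1 + e^{-s}) - log(1 - e^{-s}) ) + (e^{-s}/2)·Ei(s) + (e^{s}/2)·Ei(-s). -/

import Mathlib

/-- The exponential integral `Ei`: for `x < 0`, `Ei(x) = -∫_{-x}^∞ e^{-t}/t dt`, and for
`x > 0`, `Ei(x) = γ + log x + Σ_{k=1}^∞ x^k/(k·k!)` (Cauchy principal value). -/
noncomputable def Ei (x : ℝ) : ℝ :=
  if x < 0 then -∫ t in Set.Ioi (-x), Real.exp (-t) / t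
  else Real.eulerMascheroniConstant + Real.log x +
    ∑' k : ℕ, x ^ (k + 1) / (((k + 1) * (k + 1).factorial : ℕ) : ℝ)

open Set Filter Topology MeasureTheory

/-- The entire function `Σ_{k ≥ 1} x^k/(k·k!)`. -/
noncomputable def eiSeries (x : ℝ) : ℝ :=
  ∑' k : ℕ, x ^ (k + 1) / (((k + 1) * (k + 1).factorial : ℕ) : ℝ)

theorem eiSeries_zero : eiSeries 0 = 0 := by
  simp [eiSeries]

theorem hasDerivAt_eiSeries_tsum (x : ℝ) :
    HasDerivAt eiSeries (∑' k : ℕ, x ^ k / ((k + 1).factorial : ℝ)) x := by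
  set r : ℝ := |x| + 1
  have hr : 0 ≤ r := by positivity
  have hsum : Summable fun k : ℕ => r ^ k / (k.factorial : ℝ) := Real.summable_pow_div_factorial r
  refine hasDerivAt_tsum_of_isPreconnected (t := Ioo (-r) r) (y₀ := 0)
    (g' := fun (k : ℕ) (y : ℝ) => y ^ k / ((k + 1).factorial : ℝ)) hsum isOpen_Ioo
    isPreconnected_Ioo ?_ ?_ ?_ ?_ ?_
  · intro n y _
    have h := (hasDerivAt_pow (n + 1) y).div_const (((n + 1) * (n + 1).factorial : ℕ) : ℝ)
    refine h.congr_deriv ?_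
    push_cast [add_tsub_cancel_right]
    have : (n : ℝ) + 1 ≠ 0 := by positivity
    rw [mul_div_mul_left _ _ this]
  · intro n y hy
    rw [norm_div, norm_pow, Real.norm_natCast]
    gcongr
    · exact (abs_lt.2 hy).le
    · exact n.le_succ
  · constructor <;> simp only [r] <;> linarith [abs_nonneg x]
  · simp
  · exact abs_lt.1 (lt_add_one |x|)

theorem hasDerivAt_eiSeries {x : ℝ} (hx : x ≠ 0) :
    HasDerivAt eiSeries ((Real.exp x - 1) / x) x := by
  convert hasDerivAt_eiSeries_tsum x using 1
  have h := NormedSpace.expSeries_div_hasSum_exp x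
  rw [← Real.exp_eq_exp_ℝ] at h
  have h1 := ((hasSum_nat_add_iff' 1).2 h).div_const x
  simp only [Finset.range_one, Finset.sum_singleton, pow_zero, Nat.factorial_zero, Nat.cast_one,
    div_one] at h1
  rw [← h1.tsum_eq]
  refine tsum_congr fun k => ?_
  field_simp
  ring

theorem continuous_eiSeries : Continuous eiSeries :=
  continuous_iff_continuousAt.2 fun x => (hasDerivAt_eiSeries_tsum x).continuousAt

theorem integral_log_mul_exp_neg :
    ∫ t in Ioi (0 : ℝ), Real.log t * Real.exp (-t) = -Real.eulerMascheroniConstant := by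
  have h := Complex.hasDerivAt_GammaIntegral (s := 1) (by simp)
  have hG : HasDerivAt Complex.Gamma
      (∫ t : ℝ in Ioi 0, (t : ℂ) ^ ((1 : ℂ) - 1) * (Real.log t * Real.exp (-t))) 1 := by
    refine h.congr_of_eventuallyEq ?_
    filter_upwards [(isOpen_lt continuous_const Complex.continuous_re).mem_nhds
      (show (0 : ℝ) < (1 : ℂ).re by simp)] with z hz using Complex.Gamma_eq_integral hz
  have hu := hG.unique Complex.hasDerivAt_Gamma_one
  simp only [sub_self, Complex.cpow_zero, one_mul] at hu
  have : ((∫ t in Ioi (0 : ℝ), Real.log t * Real.exp (-t) : ℝ) : ℂ) =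
      ((-Real.eulerMascheroniConstant : ℝ) : ℂ) := by
    rw [← integral_complex_ofReal]
    push_cast at hu ⊢
    exact hu
  exact_mod_cast this

theorem integrableOn_log_mul_exp_neg :
    IntegrableOn (fun t : ℝ => Real.log t * Real.exp (-t)) (Ioi 0) := by
  by_contra h
  have h0 := integral_log_mul_exp_neg
  rw [integral_undef h] at h0
  linarith [Real.one_half_lt_eulerMascheroniConstant]

theorem integrableOn_exp_neg_div {s : ℝ} (hs : 0 < s) :
    IntegrableOn (fun t : ℝ => Real.exp (-t) / t) (Ioi s) := by
  have h : IntegrableOn (fun t : ℝ => Real.exp (-t)) (Ioi s) := by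
    simpa using exp_neg_integrableOn_Ioi s one_pos
  refine (h.div_const s).mono' (Measurable.aestronglyMeasurable (by fun_prop)) ?_
  filter_upwards [ae_restrict_mem measurableSet_Ioi] with t ht
  have ht' : s < t := ht
  rw [norm_div, Real.norm_eq_abs, Real.abs_exp, Real.norm_eq_abs, abs_of_pos (hs.trans ht')]
  gcongr

theorem tendsto_one_sub_exp_neg_mul_log :
    Tendsto (fun t : ℝ => (1 - Real.exp (-t)) * Real.log t) (𝓝[≥] 0) (𝓝 0) := by
  have h : Tendsto (fun t : ℝ => |t * Real.log t|) (𝓝[≥] 0) (𝓝 0) := by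
    simpa using (Real.continuous_mul_log.abs.tendsto 0).mono_left nhdsWithin_le_nhds
  refine squeeze_zero_norm' ?_ h
  filter_upwards [self_mem_nhdsWithin] with t (ht : 0 ≤ t)
  rw [Real.norm_eq_abs, abs_mul, abs_mul]
  refine mul_le_mul_of_nonneg_right ?_ (abs_nonneg _)
  rw [abs_of_nonneg (by simpa using ht), abs_of_nonneg ht]
  linarith [Real.add_one_le_exp (-t)]

theorem integral_exp_neg_div {s : ℝ} (hs : 0 < s) :
    ∫ t in Ioi s, Real.exp (-t) / t =
      -(Real.eulerMascheroniConstant + Real.log s + eiSeries (-s)) := by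
  have hint := integrableOn_log_mul_exp_neg
  have hexp (t : ℝ) : HasDerivAt (fun t : ℝ => Real.exp (-t)) (-Real.exp (-t)) t := by
    simpa using (hasDerivAt_id t).neg.exp
  have hnear : ∫ t in (0 : ℝ)..s, Real.log t * Real.exp (-t) =
      (1 - Real.exp (-s)) * Real.log s + eiSeries (-s) := by
    have hE : Continuous fun t => eiSeries (-t) := continuous_eiSeries.comp continuous_neg
    rw [intervalIntegral.integral_eq_sub_of_hasDerivAt_of_le hs.le
      (f := fun t => (1 - Real.exp (-t)) * Real.log t + eiSeries (-t))]
    · simp [eiSeries_zero]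
    · intro t ht
      refine ContinuousWithinAt.add ?_ hE.continuousWithinAt
      rcases ht.1.eq_or_lt with rfl | h0
      · have := tendsto_one_sub_exp_neg_mul_log.mono_left (nhdsWithin_mono 0
          (Icc_subset_Ici_self : Icc 0 s ⊆ Ici 0))
        simpa [ContinuousWithinAt] using this
      · exact (ContinuousAt.mul (by fun_prop)
          (Real.continuousAt_log h0.ne')).continuousWithinAt
    · intro t ht
      have hne : t ≠ 0 := ht.1.ne'
      have h1 := ((hexp t).const_sub 1).mul (Real.hasDerivAt_log hne)
      have h2 := (hasDerivAt_eiSeries (neg_ne_zero.2 hne)).comp t (hasDerivAt_neg t)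
      refine (h1.add h2).congr_deriv ?_
      field_simp
      ring
    · exact (intervalIntegrable_iff_integrableOn_Ioc_of_le hs.le).2
        (hint.mono_set Ioc_subset_Ioi_self)
  have hlim : Tendsto (fun t : ℝ => -(Real.exp (-t) * Real.log t)) atTop (𝓝 0) := by
    have h := Real.tendsto_pow_mul_exp_neg_atTop_nhds_zero 1
    have h' : Tendsto (fun t : ℝ => Real.exp (-t) * Real.log t) atTop (𝓝 0) := by
      refine squeeze_zero_norm' ?_ h
      filter_upwards [eventually_ge_atTop 1] with t ht
      rw [Real.norm_eq_abs, abs_mul, Real.abs_exp, abs_of_nonneg (Real.log_nonneg ht), pow_one,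
        mul_comm]
      gcongr
      exact Real.log_le_self (by linarith)
    simpa using h'.neg
  have hfar : ∫ t in Ioi s, (Real.log t * Real.exp (-t) - Real.exp (-t) / t) =
      0 - -(Real.exp (-s) * Real.log s) := by
    refine integral_Ioi_of_hasDerivAt_of_tendsto' (fun t ht => ?_)
      ((hint.mono_set (Ioi_subset_Ioi hs.le)).sub (integrableOn_exp_neg_div hs)) hlim
    have hne : t ≠ 0 := (hs.trans_le ht).ne'
    refine ((hexp t).mul (Real.hasDerivAt_log hne)).neg.congr_deriv ?_
    simp only [Pi.sub_apply]
    field_simp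
    ring
  rw [integral_sub (hint.mono_set (Ioi_subset_Ioi hs.le)) (integrableOn_exp_neg_div hs)] at hfar
  have hsplit := intervalIntegral.integral_interval_add_Ioi hint
    (hint.mono_set (Ioi_subset_Ioi hs.le))
  rw [integral_log_mul_exp_neg, hnear] at hsplit
  linarith

theorem Ei_neg_eq {s : ℝ} (hs : 0 < s) :
    Ei (-s) = Real.eulerMascheroniConstant + Real.log s + eiSeries (-s) := by
  rw [Ei, if_pos (neg_lt_zero.2 hs), neg_neg, integral_exp_neg_div hs, neg_neg]

theorem Ei_sub_Ei_neg {s : ℝ} (hs : 0 < s) : Ei s - Ei (-s) = eiSeries s - eiSeries (-s) := by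
  rw [Ei_neg_eq hs, Ei, if_neg hs.not_gt, ← eiSeries]
  ring

theorem integrableOn_mul_exp_neg_mul {b : ℝ} (hb : 0 < b) :
    IntegrableOn (fun x => x * Real.exp (-(b * x))) (Ioi 0) := by
  have h := integrableOn_rpow_mul_exp_neg_mul_rpow (s := 1) (p := 1) (b := b)
    (by norm_num) one_pos hb
  simpa using h

theorem integral_mul_exp_neg_mul {b : ℝ} (hb : 0 < b) :
    ∫ x in Ioi (0 : ℝ), x * Real.exp (-(b * x)) = 1 / b ^ 2 := by
  have h := Real.integral_rpow_mul_exp_neg_mul_Ioi (a := 2) two_pos hb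
  rw [Real.Gamma_two] at h
  norm_num at h
  simpa using h

theorem abs_sin_mul_le (a : ℝ) {x : ℝ} (hx : 0 ≤ x) : |Real.sin (a * x)| ≤ |a| * x := by
  simpa [abs_mul, abs_of_nonneg hx] using Real.abs_sin_le_abs (x := a * x)

theorem integrableOn_sin_mul_exp_neg_mul (a : ℝ) {b : ℝ} (hb : 0 < b) :
    IntegrableOn (fun x => Real.sin (a * x) * Real.exp (-(b * x))) (Ioi 0) := by
  refine ((integrableOn_mul_exp_neg_mul hb).const_mul |a|).mono'
    (Continuous.aestronglyMeasurable (by fun_prop)) ?_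
  filter_upwards [ae_restrict_mem measurableSet_Ioi] with x hx
  rw [Real.norm_eq_abs, abs_mul, Real.abs_exp, ← mul_assoc]
  gcongr
  exact abs_sin_mul_le a (le_of_lt hx)

theorem integral_sin_mul_exp_neg_mul (a : ℝ) {b : ℝ} (hb : 0 < b) :
    ∫ x in Ioi (0 : ℝ), Real.sin (a * x) * Real.exp (-(b * x)) = a / (a ^ 2 + b ^ 2) := by
  have hne : a ^ 2 + b ^ 2 ≠ 0 := by positivity
  have hlin (c : ℝ) (x : ℝ) : HasDerivAt (fun y : ℝ => c * y) c x := by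
    simpa using (hasDerivAt_id x).const_mul c
  have hd : ∀ x ∈ Ici (0 : ℝ), HasDerivAt
      (fun x => -(Real.exp (-(b * x)) * (b * Real.sin (a * x) + a * Real.cos (a * x)))
        / (a ^ 2 + b ^ 2)) (Real.sin (a * x) * Real.exp (-(b * x))) x := by
    intro x _
    have h := ((hlin b x).neg.exp.mul (((hlin a x).sin.const_mul b).add
      ((hlin a x).cos.const_mul a))).neg.div_const (a ^ 2 + b ^ 2)
    refine h.congr_deriv ?_
    simp only [Pi.add_apply, Pi.neg_apply]
    field_simp
    ring
  have hexp : Tendsto (fun x : ℝ => Real.exp (-(b * x))) atTop (𝓝 0) :=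
    Real.tendsto_exp_neg_atTop_nhds_zero.comp (tendsto_id.const_mul_atTop hb)
  have ht : Tendsto
      (fun x => -(Real.exp (-(b * x)) * (b * Real.sin (a * x) + a * Real.cos (a * x)))
        / (a ^ 2 + b ^ 2)) atTop (𝓝 0) := by
    have hz : Tendsto (fun x => Real.exp (-(b * x)) *
        (b * Real.sin (a * x) + a * Real.cos (a * x))) atTop (𝓝 0) := by
      refine hexp.zero_mul_isBoundedUnder_le (isBoundedUnder_of ⟨|b| + |a|, fun x => ?_⟩)
      calc ‖b * Real.sin (a * x) + a * Real.cos (a * x)‖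
          ≤ |b * Real.sin (a * x)| + |a * Real.cos (a * x)| := norm_add_le _ _
        _ ≤ |b| + |a| := by
          rw [abs_mul, abs_mul]
          gcongr
          · exact mul_le_of_le_one_right (abs_nonneg _) (Real.abs_sin_le_one _)
          · exact mul_le_of_le_one_right (abs_nonneg _) (Real.abs_cos_le_one _)
    simpa using hz.neg.div_const (a ^ 2 + b ^ 2)
  rw [integral_Ioi_of_hasDerivAt_of_tendsto' hd (integrableOn_sin_mul_exp_neg_mul a hb) ht]
  simp
  ring

theorem hasSum_exp_neg_mul {y : ℝ} (hy : 0 < y) :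
    HasSum (fun n : ℕ => Real.exp (-((n + 1) * y))) (1 / (Real.exp y - 1)) := by
  have h := (hasSum_geometric_of_lt_one (Real.exp_nonneg (-y))
    (by simpa using hy)).mul_left (Real.exp (-y))
  have hne : Real.exp y - 1 ≠ 0 := (sub_pos.2 (Real.one_lt_exp_iff.2 hy)).ne'
  have hval : 1 / (Real.exp y - 1) = Real.exp (-y) * (1 - Real.exp (-y))⁻¹ := by
    have h1 : 1 - Real.exp (-y) = Real.exp (-y) * (Real.exp y - 1) := by
      rw [mul_sub, ← Real.exp_add]
      simp
    rw [h1]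
    field_simp
  rw [hval]
  refine h.congr_fun fun n => ?_
  rw [← Real.exp_nat_mul, ← Real.exp_add]
  congr 1
  ring

theorem hasSum_coth (a : ℝ) :
    HasSum (fun n : ℕ => a / (a ^ 2 + ((n + 1) * Real.pi) ^ 2))
      ((Real.cosh a / Real.sinh a - 1 / a) / 2) := by
  rcases eq_or_ne a 0 with rfl | ha
  · simp
  have hπ : (Real.pi : ℂ) ≠ 0 := by exact_mod_cast Real.pi_ne_zero
  have haC : (a : ℂ) ≠ 0 := by exact_mod_cast ha
  set z : ℂ := a * Complex.I / Real.pi with hz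
  have hzmem : z ∈ Complex.integerComplement := by
    rintro ⟨n, hn⟩
    have him := congrArg Complex.im hn
    rw [hz, Complex.div_ofReal_im] at him
    simp at him
    exact div_ne_zero ha Real.pi_ne_zero him.symm
  have hsum := (summable_cotTerm hzmem).hasSum
  have hcot : ∑' n, cotTerm z n = Real.pi * Complex.cot (Real.pi * z) - 1 / z :=
    (cot_series_rep' hzmem).symm
  rw [hcot] at hsum
  have h := hsum.mul_left (Complex.I / (2 * Real.pi))
  have hsinh : Complex.sinh a ≠ 0 := by
    rw [← Complex.ofReal_sinh]
    exact_mod_cast mt Real.sinh_eq_zero.1 ha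
  have hval : Complex.I / (2 * Real.pi) * (Real.pi * Complex.cot (Real.pi * z) - 1 / z) =
      (((Real.cosh a / Real.sinh a - 1 / a) / 2 : ℝ) : ℂ) := by
    rw [show (Real.pi : ℂ) * z = a * Complex.I by rw [hz]; field_simp,
      Complex.cot_eq_cos_div_sin, Complex.cos_mul_I, Complex.sin_mul_I, hz]
    push_cast
    field_simp
  rw [hval] at h
  rw [← Complex.hasSum_ofReal]
  refine h.congr_fun fun n => ?_
  have hden : (a : ℂ) ^ 2 + ((n + 1) * Real.pi) ^ 2 ≠ 0 := by
    have : a ^ 2 + (((n : ℝ) + 1) * Real.pi) ^ 2 ≠ 0 := by positivity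
    exact_mod_cast this
  rw [cotTerm_identity hzmem]
  have hz2 : (z + (n + 1)) * (z - (n + 1)) =
      -((a : ℂ) ^ 2 + ((n + 1) * Real.pi) ^ 2) / Real.pi ^ 2 := by
    rw [hz]
    field_simp
    ring_nf
    simp
  rw [hz2, hz]
  push_cast
  field_simp
  simp [neg_div]

theorem mul_exp_half_le {y : ℝ} (hy : 0 ≤ y) : y * Real.exp (y / 2) ≤ Real.exp y - 1 := by
  have h : y / 2 ≤ Real.sinh (y / 2) := Real.self_le_sinh_iff.2 (by positivity)
  have hy2 : Real.exp y = Real.exp (y / 2) * Real.exp (y / 2) := by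
    rw [← Real.exp_add, add_halves]
  have h1 : Real.exp (-(y / 2)) * Real.exp (y / 2) = 1 := by rw [← Real.exp_add]; simp
  rw [Real.sinh_eq] at h
  nlinarith [mul_le_mul_of_nonneg_right h (Real.exp_nonneg (y / 2))]

theorem abs_sin_mul_div_exp_le (a : ℝ) {x : ℝ} (hx : 0 < x) :
    |Real.sin (a * x) / (Real.exp (Real.pi * x) - 1)| ≤
      |a| * (Real.exp (-(Real.pi / 2 * x)) / Real.pi) := by
  have hπ := Real.pi_pos
  have hpos : 0 < Real.exp (Real.pi * x) - 1 :=
    sub_pos.2 (Real.one_lt_exp_iff.2 (by positivity))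
  have h := mul_exp_half_le (y := Real.pi * x) (by positivity)
  rw [abs_div, abs_of_pos hpos, div_le_iff₀ hpos]
  calc |Real.sin (a * x)| ≤ |a| * x := abs_sin_mul_le a hx.le
    _ = |a| * (Real.exp (-(Real.pi / 2 * x)) / Real.pi) *
        (Real.pi * x * Real.exp (Real.pi * x / 2)) := by
      have h1 : Real.exp (-(Real.pi / 2 * x)) * Real.exp (Real.pi * x / 2) = 1 := by
        rw [← Real.exp_add, Real.exp_eq_one_iff]
        ring
      have h2 : Real.pi * Real.pi⁻¹ = 1 := mul_inv_cancel₀ hπ.ne'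
      rw [div_eq_mul_inv]
      linear_combination (-(|a| * x)) * h2 - |a| * x * Real.pi * Real.pi⁻¹ * h1
    _ ≤ _ := by gcongr

theorem integrableOn_exp_neg_pi_half :
    IntegrableOn (fun x : ℝ => Real.exp (-(Real.pi / 2 * x)) / Real.pi) (Ioi 0) := by
  simpa [neg_mul, IntegrableOn] using
    (exp_neg_integrableOn_Ioi 0 Real.pi_div_two_pos).div_const Real.pi

theorem integrableOn_sin_mul_div_exp (a : ℝ) :
    IntegrableOn (fun x => Real.sin (a * x) / (Real.exp (Real.pi * x) - 1)) (Ioi 0) := by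
  refine (integrableOn_exp_neg_pi_half.const_mul |a|).mono'
    (Measurable.aestronglyMeasurable (by fun_prop)) ?_
  filter_upwards [ae_restrict_mem measurableSet_Ioi] with x hx
  exact abs_sin_mul_div_exp_le a hx

theorem integral_sin_mul_div_exp (a : ℝ) :
    ∫ x in Ioi (0 : ℝ), Real.sin (a * x) / (Real.exp (Real.pi * x) - 1) =
      (Real.cosh a / Real.sinh a - 1 / a) / 2 := by
  have hb (n : ℕ) : 0 < ((n : ℝ) + 1) * Real.pi := by positivity
  have hsummable : Summable fun n : ℕ => |a| * (1 / (((n : ℝ) + 1) * Real.pi) ^ 2) := by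
    have h := ((summable_nat_add_iff 1).2
      (Real.summable_one_div_nat_pow.2 one_lt_two)).mul_left (|a| / Real.pi ^ 2)
    refine h.congr fun n => ?_
    push_cast
    field_simp
  have h := hasSum_integral_of_summable_integral_norm (μ := volume.restrict (Ioi (0 : ℝ)))
    (F := fun (n : ℕ) x => Real.sin (a * x) * Real.exp (-(((n : ℝ) + 1) * Real.pi * x)))
    (fun n => integrableOn_sin_mul_exp_neg_mul a (hb n)) ?_
  · simp_rw [fun n : ℕ => integral_sin_mul_exp_neg_mul a (hb n)] at h
    rw [← h.unique (hasSum_coth a)]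
    refine setIntegral_congr_fun measurableSet_Ioi fun x (hx : 0 < x) => ?_
    have hx := (hasSum_exp_neg_mul (y := Real.pi * x) (by positivity)).mul_left (Real.sin (a * x))
    simp only [← mul_assoc] at hx
    simp only [hx.tsum_eq, mul_one_div]
  · refine hsummable.of_nonneg_of_le (fun n => integral_nonneg fun x => norm_nonneg _) fun n => ?_
    rw [← integral_mul_exp_neg_mul (hb n), ← integral_const_mul]
    refine setIntegral_mono_on (integrableOn_sin_mul_exp_neg_mul a (hb n)).norm
      ((integrableOn_mul_exp_neg_mul (hb n)).const_mul _) measurableSet_Ioi fun x hx => ?_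
    rw [Real.norm_eq_abs, abs_mul, Real.abs_exp, ← mul_assoc]
    gcongr
    exact abs_sin_mul_le a (le_of_lt hx)

/-- The Langevin function `coth a - 1/a`. -/
noncomputable def langevin (a : ℝ) : ℝ := Real.cosh a / Real.sinh a - 1 / a

theorem measurable_langevin : Measurable langevin := by
  unfold langevin
  fun_prop

theorem exists_abs_langevin_le : ∃ C, ∀ a, |langevin a| ≤ C * |a| := by
  refine ⟨2 * ∫ x in Ioi (0 : ℝ), Real.exp (-(Real.pi / 2 * x)) / Real.pi, fun a => ?_⟩
  have h := integral_sin_mul_div_exp a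
  have hle : |∫ x in Ioi (0 : ℝ), Real.sin (a * x) / (Real.exp (Real.pi * x) - 1)| ≤
      |a| * ∫ x in Ioi (0 : ℝ), Real.exp (-(Real.pi / 2 * x)) / Real.pi := by
    rw [← integral_const_mul, ← Real.norm_eq_abs]
    refine norm_integral_le_of_norm_le (integrableOn_exp_neg_pi_half.const_mul |a|) ?_
    filter_upwards [ae_restrict_mem measurableSet_Ioi] with x hx
    exact abs_sin_mul_div_exp_le a hx
  rw [h, abs_div, abs_two] at hle
  rw [langevin]
  linarith

theorem integrableOn_exp_neg_mul_langevin (c : ℝ) :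
    IntegrableOn (fun v => Real.exp (-v) * langevin v) (Ioi c) := by
  obtain ⟨C, hC⟩ := exists_abs_langevin_le
  have hmaj : IntegrableOn
      (fun v : ℝ => 2 * C * (Real.exp (-(1 / 2) * v) + Real.exp (-(3 / 2) * v))) (Ioi c) :=
    ((exp_neg_integrableOn_Ioi c (by norm_num)).add
      (exp_neg_integrableOn_Ioi c (by norm_num))).const_mul _
  have hC0 : 0 ≤ C := by simpa using (abs_nonneg _).trans (hC 1)
  refine hmaj.mono' (Measurable.aestronglyMeasurable
    ((by fun_prop : Measurable fun v : ℝ => Real.exp (-v)).mul measurable_langevin)) ?_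
  refine ae_of_all _ fun v => ?_
  have hv : |v| ≤ 2 * (Real.exp (v / 2) + Real.exp (-(v / 2))) := by
    have h1 := Real.add_one_le_exp (v / 2)
    have h2 := Real.add_one_le_exp (-(v / 2))
    have h3 := Real.exp_pos (v / 2)
    have h4 := Real.exp_pos (-(v / 2))
    exact abs_le.2 ⟨by linarith, by linarith⟩
  have e1 : Real.exp (-(1 / 2) * v) = Real.exp (-v) * Real.exp (v / 2) := by
    rw [← Real.exp_add]
    ring_nf
  have e2 : Real.exp (-(3 / 2) * v) = Real.exp (-v) * Real.exp (-(v / 2)) := by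
    rw [← Real.exp_add]
    ring_nf
  rw [Real.norm_eq_abs, abs_mul, Real.abs_exp, e1, e2]
  calc Real.exp (-v) * |langevin v|
      ≤ Real.exp (-v) * (C * (2 * (Real.exp (v / 2) + Real.exp (-(v / 2))))) := by
        gcongr
        exact (hC v).trans (by gcongr)
    _ = _ := by ring

theorem integrableOn_exp_neg_mul_langevin_add (s : ℝ) :
    IntegrableOn (fun u => Real.exp (-u) * langevin (u + s)) (Ioi 0) := by
  have h := ((measurePreserving_add_right volume s).integrableOn_comp_preimage
    (measurableEmbedding_addRight s)).2 (integrableOn_exp_neg_mul_langevin s)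
  have h' := h.const_mul (Real.exp s)
  simp only [preimage_add_const_Ioi, sub_self] at h'
  refine h'.congr (ae_of_all _ fun u => ?_)
  simp only [Function.comp_apply]
  rw [← mul_assoc, ← Real.exp_add]
  ring_nf

theorem integral_exp_neg_mul_langevin_add (s : ℝ) :
    ∫ u in Ioi (0 : ℝ), Real.exp (-u) * langevin (u + s) =
      Real.exp s * ∫ v in Ioi s, Real.exp (-v) * langevin v := by
  have h := (measurePreserving_add_right volume s).setIntegral_preimage_emb
    (measurableEmbedding_addRight s) (fun v => Real.exp (-v) * langevin v) (Ioi s)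
  rw [← h, ← integral_const_mul, preimage_add_const_Ioi, sub_self]
  congr 1
  ext u
  rw [← mul_assoc, ← Real.exp_add]
  ring_nf

theorem integral_Ioi_exp_neg_mul_langevin {s : ℝ} (hs : 0 < s) :
    ∫ v in Ioi s, Real.exp (-v) * langevin v =
      Real.log (1 + Real.exp (-s)) - Real.log (1 - Real.exp (-s)) - Real.exp (-s) + Ei (-s) := by
  have hexp (t : ℝ) : HasDerivAt (fun t : ℝ => Real.exp (-t)) (-Real.exp (-t)) t := by
    simpa using (hasDerivAt_id t).neg.exp
  have hint := integrableOn_exp_neg_mul_langevin s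
  have hint' := integrableOn_exp_neg_div hs
  have hlim : Tendsto (fun v : ℝ => Real.exp (-v) - Real.log (1 + Real.exp (-v)) +
      Real.log (1 - Real.exp (-v))) atTop (𝓝 0) := by
    have h0 := Real.tendsto_exp_neg_atTop_nhds_zero
    have h := (h0.sub ((h0.const_add 1).log (by norm_num))).add ((h0.const_sub 1).log (by norm_num))
    simpa using h
  have h : ∫ v in Ioi s, (Real.exp (-v) * langevin v + Real.exp (-v) / v) =
      0 - (Real.exp (-s) - Real.log (1 + Real.exp (-s)) + Real.log (1 - Real.exp (-s))) := by
    refine integral_Ioi_of_hasDerivAt_of_tendsto' (fun v hv => ?_) (hint.add hint') hlim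
    have hv0 : 0 < v := hs.trans_le hv
    have hq : Real.exp (-v) < 1 := by simpa using hv0
    have hq0 := Real.exp_pos (-v)
    have h1 : 1 + Real.exp (-v) ≠ 0 := by positivity
    have h2 : 1 - Real.exp (-v) ≠ 0 := (sub_pos.2 hq).ne'
    have hd := ((hexp v).sub (((hexp v).const_add 1).log h1)).add (((hexp v).const_sub 1).log h2)
    refine hd.congr_deriv ?_
    have hev : Real.exp v = 1 / Real.exp (-v) := by rw [Real.exp_neg]; simp
    have h3 : 1 - Real.exp (-v) ^ 2 ≠ 0 := by
      have : 1 - Real.exp (-v) ^ 2 = (1 + Real.exp (-v)) * (1 - Real.exp (-v)) := by ring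
      rw [this]
      exact mul_ne_zero h1 h2
    simp only [Pi.add_apply, langevin, Real.cosh_eq, Real.sinh_eq, hev]
    field_simp
    ring
  rw [integral_add hint hint'] at h
  rw [Ei, if_pos (neg_lt_zero.2 hs), neg_neg]
  linarith

theorem integral_neg_self_exp_neg_mul_langevin {s : ℝ} (hs : 0 < s) :
    ∫ v in (-s)..s, Real.exp (-v) * langevin v = -2 * Real.sinh s + (Ei s - Ei (-s)) := by
  have hint (a b : ℝ) (hab : a ≤ b) :
      IntervalIntegrable (fun v => Real.exp (-v) * langevin v) volume a b :=
    (intervalIntegrable_iff_integrableOn_Ioc_of_le hab).2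
      ((integrableOn_exp_neg_mul_langevin a).mono_set Ioc_subset_Ioi_self)
  have hneg := ((IntervalIntegrable.iff_comp_neg enorm_ne_top).1 (hint (-s) 0 (by linarith))).symm
  simp only [neg_neg, neg_zero] at hneg
  have hsum : ∫ v in (0 : ℝ)..s, (Real.exp v * langevin (-v) + Real.exp (-v) * langevin v) =
      -2 * Real.sinh s + (Ei s - Ei (-s)) := by
    rw [intervalIntegral.integral_eq_sub_of_hasDerivAt_of_le hs.le
      (f := fun v => -2 * Real.sinh v + (eiSeries v - eiSeries (-v))), Ei_sub_Ei_neg hs]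
    · simp
    · exact ((Real.continuous_sinh.const_mul _).add (continuous_eiSeries.sub
        (continuous_eiSeries.comp continuous_neg))).continuousOn
    · intro v hv
      have hne : v ≠ 0 := hv.1.ne'
      have hsinh : Real.sinh v ≠ 0 := mt Real.sinh_eq_zero.1 hne
      have hd := ((Real.hasDerivAt_sinh v).const_mul (-2)).add ((hasDerivAt_eiSeries hne).sub
        ((hasDerivAt_eiSeries (neg_ne_zero.2 hne)).comp v (hasDerivAt_neg v)))
      refine hd.congr_deriv ?_
      have h1 : Real.exp v = Real.cosh v + Real.sinh v := (Real.cosh_add_sinh v).symm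
      have h2 : Real.exp (-v) = Real.cosh v - Real.sinh v := (Real.cosh_sub_sinh v).symm
      simp only [langevin, Real.cosh_neg, Real.sinh_neg, h1, h2]
      field_simp
      ring
    · exact hneg.add (hint 0 s hs.le)
  rw [intervalIntegral.integral_add hneg (hint 0 s hs.le)] at hsum
  have hflip := intervalIntegral.integral_comp_neg (a := 0) (b := s)
    (fun v => Real.exp (-v) * langevin v)
  simp only [neg_neg, neg_zero] at hflip
  rw [← hsum, hflip]
  exact (intervalIntegral.integral_add_adjacent_intervals (hint (-s) 0 (by linarith))
    (hint 0 s hs.le)).symm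

theorem integral_sin_mul_exp_neg (x : ℝ) :
    ∫ u in Ioi (0 : ℝ), Real.sin (x * u) * Real.exp (-u) = x / (1 + x ^ 2) := by
  simpa [add_comm] using integral_sin_mul_exp_neg_mul x one_pos

theorem integrable_prod_exp_neg_mul_sin_mul_cos (s : ℝ) :
    Integrable (fun p : ℝ × ℝ => Real.exp (-p.1) * Real.sin (p.1 * p.2) *
      Real.cos (s * p.2) / (Real.exp (Real.pi * p.2) - 1))
      ((volume.restrict (Ioi 0)).prod (volume.restrict (Ioi 0))) := by
  have h1 : IntegrableOn (fun u : ℝ => u * Real.exp (-u)) (Ioi 0) := by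
    simpa using integrableOn_mul_exp_neg_mul one_pos
  refine (h1.mul_prod integrableOn_exp_neg_pi_half).mono'
    (Measurable.aestronglyMeasurable (by fun_prop)) ?_
  rw [Measure.prod_restrict]
  filter_upwards [ae_restrict_mem (measurableSet_Ioi.prod measurableSet_Ioi)] with p hp
  obtain ⟨hu : 0 < p.1, hx : 0 < p.2⟩ := hp
  have h := abs_sin_mul_div_exp_le p.1 hx
  calc ‖Real.exp (-p.1) * Real.sin (p.1 * p.2) * Real.cos (s * p.2) /
        (Real.exp (Real.pi * p.2) - 1)‖
      = Real.exp (-p.1) * |Real.sin (p.1 * p.2) / (Real.exp (Real.pi * p.2) - 1)| *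
        |Real.cos (s * p.2)| := by
        rw [← Real.abs_exp (-p.1), ← abs_mul, ← abs_mul, Real.norm_eq_abs, Real.abs_exp]
        ring_nf
    _ ≤ Real.exp (-p.1) * (|p.1| * (Real.exp (-(Real.pi / 2 * p.2)) / Real.pi)) * 1 := by
        gcongr
        exact Real.abs_cos_le_one _
    _ = _ := by
        rw [abs_of_pos hu]
        ring

theorem integral_cos_mul_eq_integral_langevin (s : ℝ) :
    ∫ x in Ioi (0 : ℝ), Real.cos (s * x) * x / ((1 + x ^ 2) * (Real.exp (Real.pi * x) - 1)) =
      ∫ u in Ioi (0 : ℝ), (Real.exp (-u) * langevin (u + s) +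
        Real.exp (-u) * langevin (u + -s)) / 4 := by
  have hswap := integral_integral_swap (f := fun u x : ℝ => Real.exp (-u) * Real.sin (u * x) *
    Real.cos (s * x) / (Real.exp (Real.pi * x) - 1)) (integrable_prod_exp_neg_mul_sin_mul_cos s)
  calc _ = ∫ x in Ioi (0 : ℝ), ∫ u in Ioi (0 : ℝ), Real.exp (-u) * Real.sin (u * x) *
        Real.cos (s * x) / (Real.exp (Real.pi * x) - 1) := by
        congr 1
        ext x
        have h := integral_sin_mul_exp_neg x
        rw [mul_comm (1 + x ^ 2), mul_div_mul_comm, ← h, ← integral_const_mul]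
        congr 1
        ext u
        rw [mul_comm x u]
        ring
    _ = _ := hswap.symm
    _ = _ := by
        congr 1
        ext u
        have hL (a : ℝ) : langevin a =
            2 * ∫ x in Ioi (0 : ℝ), Real.sin (a * x) / (Real.exp (Real.pi * x) - 1) := by
          rw [integral_sin_mul_div_exp, langevin]
          ring
        rw [hL, hL, ← mul_add, ← mul_add, ← integral_add (integrableOn_sin_mul_div_exp _)
          (integrableOn_sin_mul_div_exp _), ← mul_assoc, mul_div_right_comm, ← integral_const_mul]
        congr 1
        ext x
        rw [add_mul, add_mul, neg_mul, Real.sin_add, Real.sin_add, Real.sin_neg, Real.cos_neg]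
        ring

/-- For every `s > 0`,
`2∫_0^∞ cos(sx) x/((1+x²)(e^{πx}-1)) dx
  = -1 + cosh(s)(log(1+e^{-s}) - log(1-e^{-s})) + (e^{-s}/2) Ei(s) + (e^{s}/2) Ei(-s)`. -/
theorem cosineTransform_sinh_khintchine (s : ℝ) (hs : 0 < s) :
    2 * ∫ x in Set.Ioi (0 : ℝ),
        Real.cos (s * x) * x / ((1 + x ^ 2) * (Real.exp (Real.pi * x) - 1)) =
      -1 + Real.cosh s * (Real.log (1 + Real.exp (-s)) - Real.log (1 - Real.exp (-s)))
        + Real.exp (-s) / 2 * Ei s + Real.exp s / 2 * Ei (-s) := by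
  have hsplit := intervalIntegral.integral_interval_add_Ioi
    (integrableOn_exp_neg_mul_langevin (-s)) (integrableOn_exp_neg_mul_langevin s)
  rw [integral_neg_self_exp_neg_mul_langevin hs, integral_Ioi_exp_neg_mul_langevin hs] at hsplit
  rw [integral_cos_mul_eq_integral_langevin, integral_div,
    integral_add (integrableOn_exp_neg_mul_langevin_add s)
      (integrableOn_exp_neg_mul_langevin_add (-s)),
    integral_exp_neg_mul_langevin_add, integral_exp_neg_mul_langevin_add, ← hsplit,
    integral_Ioi_exp_neg_mul_langevin hs, Real.sinh_eq, Real.cosh_eq]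
  have h1 : Real.exp s * Real.exp (-s) = 1 := by rw [← Real.exp_add]; simp
  linear_combination (-1 : ℝ) * h1
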